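/- Let r > 0, T > 0, λ ∈ ℝ and set ϖ = 1/(r²(1+r²)). Then there exists a C² function u : ℝ² → ℝ with u(t,θ+2π) = u(t,θ) for all (t,θ), nonconstant on [0,T]×ℝ, satisfying (1/(1+r²))∂²u/∂t² + (1/r²)∂²u/∂θ² + (ϖ + λ)u = 0 at every point of [0,T]×ℝ and the Neumann conditions ∂u/∂t(0,θ) = ∂u/∂t(T,θ) = 0 for all θ, if and only if there exist integers m ≥ 0 and n ≥ 0 with (m,n) ≠ (0,0) such that λ = m²π²/((1+r²)T²) + (n²(1+r²) − 1)/(r²(1+r²)). -/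

import Mathlib

open Real

lemma kc_fourier (L a : ℝ) (hL : 0 < L) (f : ℝ → ℝ) (hf : Continuous f) (hp : f a = f (a + L))
    (h : ∀ n : ℤ, n ≠ 0 → ∀ δ : ℝ, ∫ x in a..a + L, f x * cos (2 * π * n / L * x + δ) = 0) :
    ∀ x ∈ Set.Ico a (a + L), f x = f a := by
  have : Fact (0 < L) := ⟨hL⟩
  let fc : ℝ → ℂ := fun x => (f x : ℂ)
  have hfc : Continuous fc := Complex.continuous_ofReal.comp hf
  let F : C(AddCircle L, ℂ) := ⟨AddCircle.liftIco L a fc,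
    AddCircle.liftIco_continuous (by simp only [fc, hp]) hfc.continuousOn⟩
  have hcoef : ∀ n : ℤ, n ≠ 0 → fourierCoeff F n = 0 := by
    intro n hn
    change fourierCoeff (AddCircle.liftIco L a fc) n = 0
    rw [fourierCoeff_liftIco_eq, fourierCoeffOn_eq_integral]
    have e : ∀ x : ℝ, fourier (-n) (x : AddCircle (a + L - a)) • fc x
        = ((f x * cos (2 * π * n / L * x + 0) : ℝ) : ℂ)
          + ((f x * cos (2 * π * n / L * x + π / 2) : ℝ) : ℂ) * Complex.I := by
      intro x
      rw [fourier_coe_apply, add_sub_cancel_left, cos_add_pi_div_two]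
      have : (2 * π * Complex.I * ((-n : ℤ) : ℂ) * x / L : ℂ)
          = ((-(2 * π * n / L * x) : ℝ) : ℂ) * Complex.I := by
        push_cast; ring
      rw [this, Complex.exp_mul_I, ← Complex.ofReal_cos, ← Complex.ofReal_sin, cos_neg, sin_neg]
      simp only [fc, smul_eq_mul, add_zero]
      push_cast; ring
    simp_rw [e]
    rw [intervalIntegral.integral_add, intervalIntegral.integral_mul_const,
      intervalIntegral.integral_ofReal, intervalIntegral.integral_ofReal, h n hn, h n hn]
    · simp
    · apply Continuous.intervalIntegrable; fun_prop
    · apply Continuous.intervalIntegrable; fun_prop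
  have hsum : Summable (fourierCoeff F) :=
    summable_of_ne_finset_zero (s := {0}) (by intro n hn; exact hcoef n (by simpa using hn))
  have hval : ∀ x : AddCircle L, F x = fourierCoeff F 0 := by
    intro x
    have h1 := has_pointwise_sum_fourier_series_of_summable hsum x
    have h2 := hasSum_single (f := fun i => fourierCoeff F i • fourier i x) 0
      (by intro n hn; simp [hcoef n hn])
    have := h1.unique h2
    simpa using this
  have hx' : ∀ x ∈ Set.Ico a (a + L), F (x : AddCircle L) = f x := by
    intro x hx
    exact AddCircle.liftIco_coe_apply (f := fc) hx
  intro x hx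
  have h1 := hx' x hx
  have h2 := hx' a ⟨le_refl _, by linarith⟩
  rw [hval] at h1 h2
  exact_mod_cast h1.symm.trans h2

lemma kc_cosine (T : ℝ) (hT : 0 < T) (g : ℝ → ℝ) (hg : Continuous g)
    (h : ∀ m : ℤ, m ≠ 0 → ∫ x in (0 : ℝ)..T, g x * cos (m * π / T * x) = 0) :
    ∀ x ∈ Set.Icc 0 T, g x = g 0 := by
  have key := kc_fourier (2 * T) (-T) (by linarith) (fun x => g |x|) (by fun_prop)
    (by
      have : -T + 2 * T = T := by ring
      simp [this]) (by
      intro m hm δ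
      have e1 : -T + 2 * T = T := by ring
      rw [e1]
      have hc : Continuous fun x : ℝ => g |x| * cos (2 * π * m / (2 * T) * x + δ) := by fun_prop
      rw [← intervalIntegral.integral_add_adjacent_intervals (b := 0)
        (hc.intervalIntegrable _ _) (hc.intervalIntegrable _ _)]
      have e2 : ∫ x in (-T)..0, g |x| * cos (2 * π * m / (2 * T) * x + δ)
          = ∫ x in (0 : ℝ)..T, g |x| * cos (2 * π * m / (2 * T) * (-x) + δ) := by
        have := intervalIntegral.integral_comp_neg (a := 0) (b := T)
          (fun x : ℝ => g |x| * cos (2 * π * m / (2 * T) * x + δ))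
        simp only [abs_neg, neg_zero] at this
        exact this.symm
      rw [e2, ← intervalIntegral.integral_add]
      · have e3 : ∫ x in (0 : ℝ)..T, (g |x| * cos (2 * π * m / (2 * T) * (-x) + δ)
            + g |x| * cos (2 * π * m / (2 * T) * x + δ))
            = ∫ x in (0 : ℝ)..T, (2 * cos δ) * (g x * cos (m * π / T * x)) := by
          apply intervalIntegral.integral_congr
          intro x hx
          rw [Set.uIcc_of_le hT.le] at hx
          have e4 : 2 * π * m / (2 * T) * x = m * π / T * x := by field_simp
          have e5 : 2 * π * m / (2 * T) * (-x) = -(m * π / T * x) := by field_simp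
          simp only [abs_of_nonneg hx.1, e4, e5, cos_add, cos_neg, sin_neg]
          ring
        rw [e3, intervalIntegral.integral_const_mul, h m hm, mul_zero]
      · apply Continuous.intervalIntegrable; fun_prop
      · apply Continuous.intervalIntegrable; fun_prop)
  have hneg : ∀ x ∈ Set.Icc 0 T, g x = g T := by
    intro x hx
    have := key (-x) ⟨by linarith [hx.2], by linarith [hx.1]⟩
    simpa [abs_of_nonneg hx.1, abs_of_pos hT] using this
  intro x hx
  rw [hneg x hx, hneg 0 ⟨le_refl _, hT.le⟩]

lemma kc_ibp (f : ℝ → ℝ) (hf : ContDiff ℝ 2 f) (a b k δ : ℝ)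
    (hb : deriv f b * cos (k * b + δ) + k * (f b * sin (k * b + δ))
      = deriv f a * cos (k * a + δ) + k * (f a * sin (k * a + δ))) :
    ∫ x in a..b, deriv (deriv f) x * cos (k * x + δ)
      = -k ^ 2 * ∫ x in a..b, f x * cos (k * x + δ) := by
  have hd : ContDiff ℝ 1 (deriv f) := by
    have : ContDiff ℝ (1 + 1) f := by simpa [one_add_one_eq_two] using hf
    exact (contDiff_succ_iff_deriv.1 this).2.2
  have hdd : Continuous (deriv (deriv f)) := hd.continuous_deriv le_rfl
  have hf0 : Continuous f := hf.continuous
  have hder : ∀ x, HasDerivAt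
      (fun x => deriv f x * cos (k * x + δ) + k * (f x * sin (k * x + δ)))
      (deriv (deriv f) x * cos (k * x + δ) + k ^ 2 * (f x * cos (k * x + δ))) x := by
    intro x
    have h1 : HasDerivAt f (deriv f x) x := (hf.differentiable (by norm_num) x).hasDerivAt
    have h2 : HasDerivAt (deriv f) (deriv (deriv f) x) x :=
      (hd.differentiable (by norm_num) x).hasDerivAt
    have h3 : HasDerivAt (fun x => k * x + δ) k x := by
      simpa using ((hasDerivAt_id x).const_mul k).add_const δ
    refine ((h2.fun_mul h3.cos).fun_add ((h1.fun_mul h3.sin).const_mul k)).congr_deriv ?_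
    ring
  have := intervalIntegral.integral_eq_sub_of_hasDerivAt (a := a) (b := b)
    (fun x _ => hder x) (by apply Continuous.intervalIntegrable; fun_prop)
  rw [intervalIntegral.integral_add, intervalIntegral.integral_const_mul, hb, sub_self] at this
  · linarith
  · apply Continuous.intervalIntegrable; fun_prop
  · apply Continuous.intervalIntegrable; fun_prop

lemma kc_partial (u : ℝ → ℝ → ℝ) (n : ℕ) (hu : ContDiff ℝ (n + 1) (Function.uncurry u)) :
    ContDiff ℝ n (Function.uncurry fun t θ => deriv (u t) θ) := by
  have e : (Function.uncurry fun t θ => deriv (u t) θ)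
      = fun p : ℝ × ℝ => fderiv ℝ (Function.uncurry u) p (0, 1) := by
    funext p
    obtain ⟨t, θ⟩ := p
    have h1 : HasFDerivAt (Function.uncurry u) (fderiv ℝ (Function.uncurry u) (t, θ)) (t, θ) :=
      (hu.differentiable (by simp) (t, θ)).hasFDerivAt
    have h2 : HasDerivAt (fun x : ℝ => (t, x)) ((0 : ℝ), (1 : ℝ)) θ :=
      (hasDerivAt_const θ t).prodMk (hasDerivAt_id θ)
    exact (h1.comp_hasDerivAt θ h2).deriv
  rw [e]
  exact (hu.fderiv_right le_rfl).clm_apply contDiff_const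

lemma kc_sq (r T lam : ℝ) (hr : 0 < r) (hT : 0 < T) (m n : ℤ)
    (h : (1 / (r ^ 2 * (1 + r ^ 2)) + lam) =
      1 / (1 + r ^ 2) * (m * π / T) ^ 2 + 1 / r ^ 2 * (n : ℝ) ^ 2) :
    lam = (m.natAbs : ℝ) ^ 2 * π ^ 2 / ((1 + r ^ 2) * T ^ 2)
        + ((n.natAbs : ℝ) ^ 2 * (1 + r ^ 2) - 1) / (r ^ 2 * (1 + r ^ 2)) := by
  have h1 : ((m.natAbs : ℝ)) ^ 2 = (m : ℝ) ^ 2 := by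
    rw [Nat.cast_natAbs]; push_cast; exact sq_abs _
  have h2 : ((n.natAbs : ℝ)) ^ 2 = (n : ℝ) ^ 2 := by
    rw [Nat.cast_natAbs]; push_cast; exact sq_abs _
  rw [h1, h2]
  have : lam = 1 / (1 + r ^ 2) * (m * π / T) ^ 2 + 1 / r ^ 2 * (n : ℝ) ^ 2
    - 1 / (r ^ 2 * (1 + r ^ 2)) := by linarith
  rw [this]
  field_simp
  ring

lemma kc_coef (r T c : ℝ) (hT : 0 < T) (u : ℝ → ℝ → ℝ)
    (hu : ContDiff ℝ 2 (Function.uncurry u))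
    (hper : ∀ t θ : ℝ, u t (θ + 2 * π) = u t θ)
    (heq : ∀ t ∈ Set.Icc (0 : ℝ) T, ∀ θ : ℝ,
        (1 / (1 + r ^ 2)) * deriv (deriv (fun x => u x θ)) t
          + (1 / r ^ 2) * deriv (deriv (u t)) θ + c * u t θ = 0)
    (hN : ∀ θ : ℝ, deriv (fun x => u x θ) 0 = 0 ∧ deriv (fun x => u x θ) T = 0)
    (m n : ℤ) (δ : ℝ) (hc : c ≠ 1 / (1 + r ^ 2) * (m * π / T) ^ 2 + 1 / r ^ 2 * (n : ℝ) ^ 2) :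
    ∫ t in (0 : ℝ)..T, (∫ θ in (0 : ℝ)..2 * π, u t θ * cos (n * θ + δ)) * cos (m * π / T * t)
      = 0 := by
  have hu0 : Continuous (Function.uncurry u) := hu.continuous
  have hswap : ContDiff ℝ 2 (Function.uncurry fun θ t => u t θ) :=
    hu.comp (contDiff_snd.prodMk contDiff_fst)
  have hA : Continuous (Function.uncurry fun t θ => deriv (deriv (u t)) θ) := by
    have h1 := kc_partial u 1 (by simpa [one_add_one_eq_two] using hu)
    exact (kc_partial (fun t => deriv (u t)) 0 (by simpa using h1)).continuous
  have hB : Continuous (Function.uncurry fun θ t => deriv (deriv (fun x => u x θ)) t) := by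
    have h1 := kc_partial (fun θ t => u t θ) 1 (by simpa [one_add_one_eq_two] using hswap)
    exact (kc_partial (fun θ => deriv (fun x => u x θ)) 0 (by simpa using h1)).continuous
  have hB' : Continuous (Function.uncurry fun t θ => deriv (deriv (fun x => u x θ)) t) :=
    hB.comp continuous_swap
  have hut : ∀ t, ContDiff ℝ 2 (u t) := fun t => hu.comp (contDiff_const.prodMk contDiff_id)
  have huθ : ∀ θ, ContDiff ℝ 2 (fun x => u x θ) :=
    fun θ => hu.comp (contDiff_id.prodMk contDiff_const)
  -- integration against the product of trigonometric functions
  let I : (ℝ → ℝ → ℝ) → ℝ := fun v =>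
    ∫ t in (0 : ℝ)..T, (∫ θ in (0 : ℝ)..2 * π, v t θ * cos (n * θ + δ)) * cos (m * π / T * t)
  have hcont : ∀ v : ℝ → ℝ → ℝ, Continuous (Function.uncurry v) →
      Continuous (fun t => ∫ θ in (0 : ℝ)..2 * π, v t θ * cos (n * θ + δ)) := by
    intro v hv
    apply intervalIntegral.continuous_parametric_intervalIntegral_of_continuous'
    exact hv.mul (by fun_prop)
  have hθθ : I (fun t θ => deriv (deriv (u t)) θ) = -(n : ℝ) ^ 2 * I u := by
    simp only [I]
    rw [← intervalIntegral.integral_const_mul]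
    congr 1
    funext t
    rw [kc_ibp (u t) (hut t) 0 (2 * π) n δ, mul_assoc]
    have p1 : u t (2 * π) = u t 0 := by simpa using hper t 0
    have p2 : deriv (u t) (2 * π) = deriv (u t) 0 := by
      have : (fun x => u t (x + 2 * π)) = u t := funext (hper t)
      have h2 := deriv_comp_add_const (u t) (2 * π) 0
      rw [this, zero_add] at h2
      exact h2.symm
    have e : (n : ℝ) * (2 * π) + δ = δ + n * (2 * π) := by ring
    rw [p1, p2, e, cos_add_int_mul_two_pi, sin_add_int_mul_two_pi]
    simp
  have hrw : ∀ v : ℝ → ℝ → ℝ, Continuous (Function.uncurry v) →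
      I v = ∫ θ in (0 : ℝ)..2 * π, (∫ t in (0 : ℝ)..T, v t θ * cos (m * π / T * t + 0))
        * cos (n * θ + δ) := by
    intro v hv
    simp only [I, ← intervalIntegral.integral_mul_const]
    rw [MeasureTheory.intervalIntegral_intervalIntegral_swap]
    · congr 1; funext θ; congr 1; funext t; rw [add_zero]; ring
    · have hc' : Continuous (Function.uncurry fun t θ =>
          v t θ * cos (n * θ + δ) * cos (m * π / T * t)) :=
        (hv.mul (by fun_prop)).mul (by fun_prop)
      exact (hc'.continuousOn.integrableOn_compact
        (isCompact_uIcc.prod isCompact_uIcc)).mono_set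
        (Set.prod_mono Set.uIoc_subset_uIcc Set.uIoc_subset_uIcc)
  have htt : I (fun t θ => deriv (deriv (fun x => u x θ)) t) = -(m * π / T) ^ 2 * I u := by
    rw [hrw _ hB', hrw _ hu0, ← intervalIntegral.integral_const_mul]
    congr 1
    funext θ
    rw [kc_ibp (fun x => u x θ) (huθ θ) 0 T (m * π / T) 0, mul_assoc]
    have e : m * π / T * T = m * π := by field_simp
    rw [(hN θ).1, (hN θ).2, e]
    simp [sin_int_mul_pi]
  have hlin : 1 / (1 + r ^ 2) * I (fun t θ => deriv (deriv (fun x => u x θ)) t)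
      + 1 / r ^ 2 * I (fun t θ => deriv (deriv (u t)) θ) + c * I u = 0 := by
    have c1 := hcont _ hB'
    have c2 := hcont _ hA
    have c3 := hcont _ hu0
    simp only [I, ← intervalIntegral.integral_const_mul]
    rw [← intervalIntegral.integral_add, ← intervalIntegral.integral_add]
    · rw [intervalIntegral.integral_congr (g := fun _ => (0 : ℝ)), intervalIntegral.integral_zero]
      intro t ht
      rw [Set.uIcc_of_le hT.le] at ht
      have d1 : Continuous fun θ => deriv (deriv (fun x => u x θ)) t :=
        hB'.comp (Continuous.prodMk_right t)
      have d2 : Continuous fun θ => deriv (deriv (u t)) θ := hA.comp (Continuous.prodMk_right t)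
      have d3 : Continuous fun θ => u t θ := hu0.comp (Continuous.prodMk_right t)
      have : (1 / (1 + r ^ 2)) * (∫ θ in (0 : ℝ)..2 * π,
            deriv (deriv (fun x => u x θ)) t * cos (n * θ + δ))
          + (1 / r ^ 2) * (∫ θ in (0 : ℝ)..2 * π, deriv (deriv (u t)) θ * cos (n * θ + δ))
          + c * (∫ θ in (0 : ℝ)..2 * π, u t θ * cos (n * θ + δ)) = 0 := by
        simp only [← intervalIntegral.integral_const_mul]
        rw [← intervalIntegral.integral_add, ← intervalIntegral.integral_add]
        · rw [intervalIntegral.integral_congr (g := fun _ => (0 : ℝ)),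
            intervalIntegral.integral_zero]
          intro θ _
          have := heq t ht θ
          simp only
          linear_combination cos (n * θ + δ) * this
        all_goals apply Continuous.intervalIntegrable; fun_prop
      simp only
      linear_combination cos (m * π / T * t) * this
    all_goals apply Continuous.intervalIntegrable; fun_prop
  rw [htt, hθθ] at hlin
  have : (c - (1 / (1 + r ^ 2) * (m * π / T) ^ 2 + 1 / r ^ 2 * (n : ℝ) ^ 2)) * I u = 0 := by
    linear_combination hlin
  exact (mul_eq_zero.1 this).resolve_left (sub_ne_zero.2 hc)

lemma kc_deriv (c k : ℝ) :
    deriv (fun x => c * cos (k * x)) = fun x => -(c * k) * sin (k * x) := by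
  funext x
  have h3 : HasDerivAt (fun x => k * x) k x := by
    simpa using (hasDerivAt_id x).const_mul k
  rw [(h3.cos.const_mul c).deriv]; ring

lemma kc_deriv2 (c k : ℝ) :
    deriv (deriv (fun x => c * cos (k * x))) = fun x => -k ^ 2 * (c * cos (k * x)) := by
  rw [kc_deriv]
  funext x
  have h3 : HasDerivAt (fun x => k * x) k x := by
    simpa using (hasDerivAt_id x).const_mul k
  rw [(h3.sin.const_mul (-(c * k))).deriv]; ring

/-- spectrum (from nonconstant eigenfunctions) of the Jacobi
operator of a truncated Killing cylinder `C_R^T` in hyperbolic 3-space with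
Neumann boundary conditions (capillary support on two totally geodesic
spheres): a nonconstant eigenfunction exists iff
`λ = m²π²/((1+r²)T²) + (n²(1+r²) − 1)/(r²(1+r²))` for some `(m,n) ≠ (0,0)`. -/
theorem killing_cylinder_neumann_spectrum
    (r T lam : ℝ) (hr : 0 < r) (hT : 0 < T) :
    (∃ u : ℝ → ℝ → ℝ,
      ContDiff ℝ 2 (Function.uncurry u) ∧
      (∀ t θ : ℝ, u t (θ + 2 * π) = u t θ) ∧
      (∃ t₁ ∈ Set.Icc (0 : ℝ) T, ∃ t₂ ∈ Set.Icc (0 : ℝ) T, ∃ θ₁ θ₂ : ℝ,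
        u t₁ θ₁ ≠ u t₂ θ₂) ∧
      (∀ t ∈ Set.Icc (0 : ℝ) T, ∀ θ : ℝ,
        (1 / (1 + r ^ 2)) * deriv (deriv (fun x => u x θ)) t
          + (1 / r ^ 2) * deriv (deriv (u t)) θ
          + (1 / (r ^ 2 * (1 + r ^ 2)) + lam) * u t θ = 0) ∧
      (∀ θ : ℝ, deriv (fun x => u x θ) 0 = 0 ∧ deriv (fun x => u x θ) T = 0)) ↔
    (∃ m n : ℕ, (m, n) ≠ (0, 0) ∧
      lam = (m : ℝ) ^ 2 * π ^ 2 / ((1 + r ^ 2) * T ^ 2)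
        + ((n : ℝ) ^ 2 * (1 + r ^ 2) - 1) / (r ^ 2 * (1 + r ^ 2))) := by
  constructor
  · rintro ⟨u, hu, hper, ⟨t₁, ht₁, t₂, ht₂, θ₁, θ₂, hne⟩, heq, hN⟩
    by_contra hcon
    apply hne
    have hcoef : ∀ m n : ℤ, (m ≠ 0 ∨ n ≠ 0) → ∀ δ : ℝ,
        ∫ t in (0 : ℝ)..T, (∫ θ in (0 : ℝ)..2 * π, u t θ * cos (n * θ + δ))
          * cos (m * π / T * t) = 0 := by
      intro m n hmn δ
      apply kc_coef r T _ hT u hu hper heq hN m n δ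
      intro hc
      exact hcon ⟨m.natAbs, n.natAbs, by simp; omega, kc_sq r T lam hr hT m n hc⟩
    have hu0 : Continuous (Function.uncurry u) := hu.continuous
    have hcont : ∀ (n : ℤ) (δ : ℝ),
        Continuous (fun t => ∫ θ in (0 : ℝ)..2 * π, u t θ * cos (n * θ + δ)) := by
      intro n δ
      apply intervalIntegral.continuous_parametric_intervalIntegral_of_continuous'
      exact hu0.mul (by fun_prop)
    have hconst : ∀ (n : ℤ) (δ : ℝ), ∀ t ∈ Set.Icc 0 T,
        ∫ θ in (0 : ℝ)..2 * π, u t θ * cos (n * θ + δ)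
          = ∫ θ in (0 : ℝ)..2 * π, u 0 θ * cos (n * θ + δ) := by
      intro n δ
      exact kc_cosine T hT _ (hcont n δ) (fun m hm => hcoef m n (Or.inl hm) δ)
    have hzero : ∀ (n : ℤ), n ≠ 0 → ∀ (δ : ℝ), ∀ t ∈ Set.Icc 0 T,
        ∫ θ in (0 : ℝ)..2 * π, u t θ * cos (n * θ + δ) = 0 := by
      intro n hn δ t ht
      rw [hconst n δ t ht]
      have h0 := hcoef 0 n (Or.inr hn) δ
      rw [intervalIntegral.integral_congr (g := fun _ =>
        ∫ θ in (0 : ℝ)..2 * π, u 0 θ * cos (n * θ + δ))] at h0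
      · rw [intervalIntegral.integral_const, sub_zero, smul_eq_mul] at h0
        exact (mul_eq_zero.1 h0).resolve_left hT.ne'
      · intro s hs
        rw [Set.uIcc_of_le hT.le] at hs
        simp [hconst n δ s hs]
    have hut : ∀ t ∈ Set.Icc 0 T, ∀ θ, u t θ = u t 0 := by
      intro t ht
      have hk := kc_fourier (2 * π) 0 two_pi_pos (u t) (hu0.comp (Continuous.prodMk_right t))
        (hper t 0).symm (by
          intro n hn δ
          rw [zero_add]
          refine Eq.trans ?_ (hzero n hn δ t ht)
          congr 1; funext θ
          have : 2 * π * n / (2 * π) = (n : ℝ) := by field_simp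
          rw [this])
      intro θ
      obtain ⟨y, hy, hy'⟩ := (show Function.Periodic (u t) (2 * π) from hper t).exists_mem_Ico
        two_pi_pos θ 0
      rw [hy', hk y hy]
    have hfin : ∀ t ∈ Set.Icc 0 T, u t 0 = u 0 0 := by
      intro t ht
      have h1 := hconst 0 0 t ht
      simp only [Int.cast_zero, zero_mul, add_zero, cos_zero, mul_one] at h1
      simp only [hut t ht, hut 0 ⟨le_refl _, hT.le⟩] at h1
      simpa [pi_ne_zero] using h1
    rw [hut t₁ ht₁, hut t₂ ht₂, hfin t₁ ht₁, hfin t₂ ht₂]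
  · rintro ⟨m, n, hmn, rfl⟩
    refine ⟨fun t θ => cos (m * π / T * t) * cos (n * θ), ?_, ?_, ?_, ?_, ?_⟩
    · unfold Function.uncurry
      fun_prop
    · intro t θ
      have : (n : ℝ) * (θ + 2 * π) = n * θ + n * (2 * π) := by ring
      simp only [this, cos_add_nat_mul_two_pi]
    · by_cases hm : m = 0
      · have hn : n ≠ 0 := by rintro rfl; exact hmn (by rw [hm])
        refine ⟨0, ⟨le_refl _, hT.le⟩, 0, ⟨le_refl _, hT.le⟩, 0, π / n, ?_⟩
        have : (n : ℝ) * (π / n) = π := by field_simp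
        simp only [this]
        norm_num
      · have hm1 : (1 : ℝ) ≤ m := by exact_mod_cast Nat.one_le_iff_ne_zero.2 hm
        refine ⟨0, ⟨le_refl _, hT.le⟩, T / m, ⟨by positivity, div_le_self hT.le hm1⟩, 0, 0, ?_⟩
        have : (m : ℝ) * π / T * (T / m) = π := by field_simp
        simp only [this]
        norm_num
    · intro t ht θ
      have e1 : (fun x => cos (m * π / T * x) * cos (n * θ))
          = fun x => cos (n * θ) * cos (m * π / T * x) := by funext x; ring
      simp only [e1, kc_deriv2]
      field_simp
      ring
    · intro θ
      have e1 : (fun x => cos (m * π / T * x) * cos (n * θ))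
          = fun x => cos (n * θ) * cos (m * π / T * x) := by funext x; ring
      have e : (m : ℝ) * π / T * T = m * π := by field_simp
      simp only [e1, kc_deriv, e]
      simp [sin_nat_mul_pi]
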